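/- The family {D^i ∘ L^j : i,j ≥ 0} of ℂ-linear endomorphisms of ℂ[[z]] (including the identity operator for i=j=0) is linearly independent over ℂ. -/

import Mathlib

noncomputable section

/-- The formal differentiation operator `D` on `ℂ[[z]]`: `(Df)(z) = ∑ (k+1) c_{k+1} z^k`. -/
def Dop : Module.End ℂ (PowerSeries ℂ) where
  toFun f := PowerSeries.mk fun k => ((k : ℂ) + 1) * PowerSeries.coeff (k + 1) f
  map_add' f g := by
    ext k
    simp [mul_add]
  map_smul' c f := by
    ext k
    simp
    ring

/-- The left translation operator `L` on `ℂ[[z]]`: `(Lf)(z) = ∑ c_{k+1} z^k`. -/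
def Lop : Module.End ℂ (PowerSeries ℂ) where
  toFun f := PowerSeries.mk fun k => PowerSeries.coeff (k + 1) f
  map_add' f g := by ext k; simp
  map_smul' c f := by ext k; simp

theorem coeff_Dop_pow (i k : ℕ) (f : PowerSeries ℂ) :
    PowerSeries.coeff k ((Dop ^ i) f) =
      ((ascPochhammer ℂ i).comp (Polynomial.X + 1)).eval (k : ℂ) *
        PowerSeries.coeff (k + i) f := by
  induction i generalizing f with
  | zero => simp
  | succ i ih =>
    rw [pow_succ, Module.End.mul_apply, ih, ascPochhammer_succ_right]
    simp [Dop]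
    ring_nf

theorem coeff_Lop_pow (j k : ℕ) (f : PowerSeries ℂ) :
    PowerSeries.coeff k ((Lop ^ j) f) = PowerSeries.coeff (k + j) f := by
  induction j generalizing f with
  | zero => simp
  | succ j ih =>
    rw [pow_succ, Module.End.mul_apply, ih]
    simp [Lop, add_assoc]

/-- The shifted rising factorials `(X + 1) (X + 2) ⋯ (X + i)` are linearly independent. -/
theorem linearIndependent_ascPochhammer_comp_X_add_one :
    LinearIndependent ℂ
      (fun i : ℕ => (ascPochhammer ℂ i).comp (Polynomial.X + 1)) := by
  have hX : (Polynomial.X + 1 : Polynomial ℂ).natDegree = 1 :=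
    Polynomial.natDegree_X_add_C (1 : ℂ)
  have hXm : (Polynomial.X + 1 : Polynomial ℂ).Monic := Polynomial.monic_X_add_C (1 : ℂ)
  let S : Polynomial.Sequence ℂ :=
    { elems' := fun i => (ascPochhammer ℂ i).comp (Polynomial.X + 1)
      degree_eq' := fun i => by
        have hm := (monic_ascPochhammer ℂ i).comp hXm (by simp [hX])
        rw [Polynomial.degree_eq_natDegree hm.ne_zero, Polynomial.natDegree_comp, hX,
          ascPochhammer_natDegree, mul_one] }
  exact S.linearIndependent

/-- the family `{Dⁱ ∘ Lʲ : i, j ≥ 0}` of endomorphisms of `ℂ[[z]]`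
(including the identity for `i = j = 0`) is linearly independent over `ℂ`. -/
theorem linearIndependent_DL_monomials :
    LinearIndependent ℂ
      (fun p : ℕ × ℕ => (Dop ^ p.1 * Lop ^ p.2 : Module.End ℂ (PowerSeries ℂ))) := by
  rw [linearIndependent_iff']
  intro s g hg p hp
  set n := p.1 + p.2 with hn
  set t := s.filter fun q => q.1 + q.2 = n with ht
  have hinj : Set.InjOn (Prod.fst : ℕ × ℕ → ℕ) t := by
    rintro ⟨a, b⟩ ha ⟨c, d⟩ hc hac
    simp only [ht, Finset.coe_filter, Set.mem_ofPred_eq] at ha hc hac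
    ext <;> simp only <;> omega
  have hsum : ∑ q ∈ t, g q • (ascPochhammer ℂ q.1).comp (Polynomial.X + 1) = 0 := by
    refine Polynomial.eq_zero_of_infinite_isRoot _
      ((Set.infinite_range_of_injective (Nat.cast_injective (R := ℂ))).mono ?_)
    rintro _ ⟨k, rfl⟩
    have h := congrArg (fun T : Module.End ℂ (PowerSeries ℂ) =>
      PowerSeries.coeff k (T (PowerSeries.X ^ (k + n)))) hg
    simp only [LinearMap.sum_apply, LinearMap.smul_apply, Module.End.mul_apply, map_sum, map_smul,
      coeff_Dop_pow, coeff_Lop_pow, PowerSeries.coeff_X_pow, LinearMap.zero_apply, map_zero,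
      add_assoc, Nat.add_left_cancel_iff, smul_eq_mul, mul_ite, mul_one, mul_zero] at h
    rw [← Finset.sum_filter] at h
    simpa only [Set.mem_ofPred_eq, Polynomial.IsRoot, Polynomial.eval_finsetSum,
      Polynomial.eval_smul, smul_eq_mul] using h
  have himage : ∑ i ∈ t.image Prod.fst,
      g (i, n - i) • (ascPochhammer ℂ i).comp (Polynomial.X + 1) = 0 := by
    rw [Finset.sum_image hinj, ← hsum]
    refine Finset.sum_congr rfl fun q hq => ?_
    rw [← (Finset.mem_filter.mp hq).2, Nat.add_sub_cancel_left]
  have hpt : p ∈ t := Finset.mem_filter.mpr ⟨hp, rfl⟩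
  have h := linearIndependent_iff'.mp linearIndependent_ascPochhammer_comp_X_add_one _ _ himage p.1
    (Finset.mem_image_of_mem _ hpt)
  rwa [hn, Nat.add_sub_cancel_left] at h
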